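/- Let N and t be natural numbers, let B ⊆ Fin N with |B| ≤ t be the set of Byzantine agents, let M be a type of message contents, and let f : Fin N → M record the unique echo message content sent by each agent for a fixed sequence number (correct agents send at most one echo, so f is well defined on agents outside B). Suppose Q₁, Q₂ ⊆ Fin N satisfy 2·|Q₁| > N + t and 2·|Q₂| > N + t, every agent a ∈ Q₁ with a ∉ B has f a = m₁, and every agent a ∈ Q₂ with a ∉ B has f a = m₂. Then m₁ = m₂. -/

import Mathlib

theorem echo_quorums_same_content
    (N t : ℕ) (B : Finset (Fin N)) (hB : B.card ≤ t)
    (M : Type*) (f : Fin N → M)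
    (Q₁ Q₂ : Finset (Fin N))
    (hQ₁ : 2 * Q₁.card > N + t)
    (hQ₂ : 2 * Q₂.card > N + t)
    (m₁ m₂ : M)
    (h₁ : ∀ a ∈ Q₁, a ∉ B → f a = m₁)
    (h₂ : ∀ a ∈ Q₂, a ∉ B → f a = m₂) :
    m₁ = m₂ := by
  have hu : (Q₁ ∪ Q₂).card ≤ N := by
    simpa using Finset.card_le_univ (Q₁ ∪ Q₂)
  have hc := Finset.card_union_add_card_inter Q₁ Q₂
  have hlt : B.card < (Q₁ ∩ Q₂).card := by omega
  obtain ⟨a, ha, hab⟩ := Finset.exists_mem_notMem_of_card_lt_card hlt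
  rw [Finset.mem_inter] at ha
  rw [← h₁ a ha.1 hab, ← h₂ a ha.2 hab]
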